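/- Let D be a positive integer, a ∈ ℝ, and b > 0. Then there exist C > 0 and a summable sequence (γ_j) of nonnegative real numbers such that ∫_{ℝ^D} exp( z·σ − a|σ|² − b|σ|⁴ ) dσ = C ∏_{j=1}^∞ (1 + γ_j z²) for all z ∈ ℂ^D. -/

import Mathlib

open MeasureTheory Complex

noncomputable section

/-- Complex bilinear dot product `z · w = Σ_j z_j w_j` (no conjugation). -/
def cdot {D : ℕ} (z w : Fin D → ℂ) : ℂ := ∑ j, z j * w j

/-- Real scalar product. -/
def rdot {D : ℕ} (x y : Fin D → ℝ) : ℝ := ∑ j, x j * y j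

/-- Pairing `z · σ = Σ_j z_j σ_j` of a complex vector with a real vector. -/
def cpair {D : ℕ} (z : Fin D → ℂ) (σ : Fin D → ℝ) : ℂ := ∑ j, z j * (σ j : ℂ)

namespace LeeYang

open Polynomial Filter Topology

/-- Real polynomials with positive constant term and no zeros off the half-line `(-∞, 0]`,
whose complement is parametrized by squares of the right half-plane. -/
def IsStable (p : ℝ[X]) : Prop :=
  0 < p.coeff 0 ∧ ∀ u : ℂ, 0 < u.re → aeval (u ^ 2) p ≠ 0

/-- The polynomial `∏ (1 + γ X)`. -/
def linProd (s : Multiset ℝ) : ℝ[X] := (s.map fun γ => 1 + C γ * X).prod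

@[simp] lemma linProd_zero : linProd 0 = 1 := by simp [linProd]

@[simp] lemma linProd_cons (γ : ℝ) (s : Multiset ℝ) :
    linProd (γ ::ₘ s) = (1 + C γ * X) * linProd s := by simp [linProd]

@[simp] lemma linProd_coeff_zero (s : Multiset ℝ) : (linProd s).coeff 0 = 1 := by
  induction s using Multiset.induction with
  | empty => simp
  | cons γ s ih => simp [ih]

lemma linProd_coeff_one (s : Multiset ℝ) : (linProd s).coeff 1 = s.sum := by
  induction s using Multiset.induction with
  | empty => simp [coeff_one]
  | cons γ s ih =>
    rw [linProd_cons, add_mul, one_mul, coeff_add, mul_assoc, coeff_C_mul, coeff_X_mul, ih]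
    simp [add_comm]

lemma exists_sq_eq_of_mem_slitPlane {z : ℂ} (hz : z ∈ slitPlane) :
    ∃ u : ℂ, 0 < u.re ∧ u ^ 2 = z := by
  have h0 := slitPlane_ne_zero hz
  refine ⟨z ^ (1 / 2 : ℂ), ?_, ?_⟩
  · rw [cpow_def_of_ne_zero h0, exp_re]
    refine mul_pos (Real.exp_pos _) (Real.cos_pos_of_mem_Ioo ?_)
    have h : (log z * (1 / 2 : ℂ)).im = z.arg / 2 := by
      rw [show (1 / 2 : ℂ) = ((1 / 2 : ℝ) : ℂ) by norm_num, im_mul_ofReal, log_im]; ring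
    rw [h]
    have h1 := neg_pi_lt_arg z
    have h2 := lt_of_le_of_ne (arg_le_pi z) (slitPlane_arg_ne_pi hz)
    constructor <;> linarith
  · rw [← cpow_nat_mul]; simp

lemma IsStable.exists_multiset {p : ℝ[X]} (hp : IsStable p) :
    ∃ s : Multiset ℝ, (∀ γ ∈ s, 0 ≤ γ) ∧ p = C (p.coeff 0) * linProd s := by
  have hp0 : p ≠ 0 := by rintro rfl; simpa using hp.1
  have hsp : p.Splits := by
    refine Splits.of_splits_map (algebraMap ℝ ℂ) (IsAlgClosed.splits _) fun a ha => ?_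
    have hroot : aeval a p = 0 := by
      rw [mem_roots (by simpa using hp0), IsRoot.def, eval_map_algebraMap] at ha
      exact ha
    have h : a ∉ slitPlane := fun h => by
      obtain ⟨u, hu, rfl⟩ := exists_sq_eq_of_mem_slitPlane h
      exact hp.2 u hu hroot
    rw [mem_slitPlane_iff] at h
    push Not at h
    exact ⟨a.re, by apply Complex.ext <;> simp [h.2]⟩
  have hneg : ∀ r ∈ p.roots, r < 0 := by
    intro r hr
    have hr0 : p.eval r = 0 := (mem_roots hp0).1 hr
    by_contra! hle
    rcases hle.eq_or_lt with h | h
    · rw [← h, ← coeff_zero_eq_eval_zero] at hr0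
      exact hp.1.ne' hr0
    · refine hp.2 (Real.sqrt r : ℝ) (by simpa using h) ?_
      rw [← ofReal_pow, Real.sq_sqrt hle]
      have := aeval_algebraMap_apply ℂ r p
      simp only [coe_algebraMap] at this
      rw [this]
      simp [hr0]
  have key : ∀ s : Multiset ℝ, (∀ r ∈ s, r < 0) → ∃ (c : ℝ) (t : Multiset ℝ),
      (∀ γ ∈ t, 0 ≤ γ) ∧ (s.map (X - C ·)).prod = C c * linProd t := by
    intro s
    induction s using Multiset.induction with
    | empty => exact fun _ => ⟨1, 0, by simp, by simp⟩
    | cons r s ih =>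
      intro h
      obtain ⟨c, t, ht, hs⟩ := ih fun x hx => h x (Multiset.mem_cons_of_mem hx)
      have hr := h r (Multiset.mem_cons_self r s)
      refine ⟨-r * c, (-r⁻¹) ::ₘ t, ?_, ?_⟩
      · intro γ hγ
        rcases Multiset.mem_cons.1 hγ with rfl | hγ
        · simpa using hr.le
        · exact ht γ hγ
      · have : (X - C r : ℝ[X]) = C (-r) * (1 + C (-r⁻¹) * X) := by
          rw [mul_add, ← mul_assoc, ← C_mul, neg_mul_neg, mul_inv_cancel₀ hr.ne]
          simp only [C_neg, C_1]; ring
        rw [Multiset.map_cons, Multiset.prod_cons, hs, this, linProd_cons, C_mul]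
        ring
  obtain ⟨c, t, ht, hprod⟩ := key p.roots hneg
  refine ⟨t, ht, ?_⟩
  have h := hsp.eq_prod_roots
  rw [hprod, ← mul_assoc, ← C_mul] at h
  have hc : p.coeff 0 = p.leadingCoeff * c := by
    conv_lhs => rw [h]
    simp
  rw [hc]
  exact h

lemma linProd_ne_zero_and_re {u : ℂ} (hu : 0 < u.re) (s : Multiset ℝ) (hs : ∀ γ ∈ s, 0 ≤ γ) :
    aeval (u ^ 2) (linProd s) ≠ 0 ∧
    0 ≤ (u * (aeval (u ^ 2) (derivative (linProd s)) / aeval (u ^ 2) (linProd s))).re ∧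
    (s.sum ≠ 0 →
      0 < (u * (aeval (u ^ 2) (derivative (linProd s)) / aeval (u ^ 2) (linProd s))).re) := by
  induction s using Multiset.induction with
  | empty => simp
  | cons γ s ih =>
    obtain ⟨h1, h2, h3⟩ := ih fun x hx => hs x (Multiset.mem_cons_of_mem hx)
    have hγ := hs γ (Multiset.mem_cons_self γ s)
    have hu0 : u ≠ 0 := by rintro rfl; simp at hu
    have hq : γ ≠ 0 → (1 + (γ : ℂ) * u ^ 2 ≠ 0) ∧ 0 < (u * (γ / (1 + (γ : ℂ) * u ^ 2))).re := by
      intro hγ0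
      have hpos : 0 < γ := lt_of_le_of_ne hγ hγ0.symm
      have hre : 0 < (u + u⁻¹ * ((γ⁻¹ : ℝ) : ℂ)).re := by
        rw [add_re, re_mul_ofReal, inv_re]
        have := normSq_pos.2 hu0
        positivity
      have hne : u + u⁻¹ * ((γ⁻¹ : ℝ) : ℂ) ≠ 0 := fun h => by rw [h] at hre; simp at hre
      have hγc : (γ : ℂ) ≠ 0 := by exact_mod_cast hγ0
      have heq : 1 + (γ : ℂ) * u ^ 2 = γ * u * (u + u⁻¹ * ((γ⁻¹ : ℝ) : ℂ)) := by
        push_cast; field_simp; ring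
      have hne' : 1 + (γ : ℂ) * u ^ 2 ≠ 0 := by
        rw [heq]; exact mul_ne_zero (mul_ne_zero hγc hu0) hne
      refine ⟨hne', ?_⟩
      have : u * (γ / (1 + (γ : ℂ) * u ^ 2)) = (u + u⁻¹ * ((γ⁻¹ : ℝ) : ℂ))⁻¹ := by
        rw [heq]; field_simp
      rw [this, inv_re]
      exact div_pos hre (normSq_pos.2 hne)
    have hlin : 1 + (γ : ℂ) * u ^ 2 ≠ 0 := by
      by_cases h : γ = 0
      · simp [h]
      · exact (hq h).1
    have hlin' : 0 ≤ (u * (γ / (1 + (γ : ℂ) * u ^ 2))).re := by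
      by_cases h : γ = 0
      · simp [h]
      · exact (hq h).2.le
    have hval : aeval (u ^ 2) (linProd (γ ::ₘ s)) =
        (1 + (γ : ℂ) * u ^ 2) * aeval (u ^ 2) (linProd s) := by simp
    have hder : u * (aeval (u ^ 2) (derivative (linProd (γ ::ₘ s))) /
        aeval (u ^ 2) (linProd (γ ::ₘ s))) = u * (γ / (1 + (γ : ℂ) * u ^ 2)) +
        u * (aeval (u ^ 2) (derivative (linProd s)) / aeval (u ^ 2) (linProd s)) := by
      rw [hval, linProd_cons, derivative_mul]
      have hlin'' : 1 + u ^ 2 * (γ : ℂ) ≠ 0 := by rwa [mul_comm (u ^ 2)]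
      simp only [derivative_one, derivative_mul, derivative_C, derivative_X,
        map_add, map_mul, aeval_C, aeval_X, map_one, map_zero, coe_algebraMap]
      field_simp
      ring
    rw [hder, hval, add_re]
    refine ⟨mul_ne_zero hlin h1, add_nonneg hlin' h2, fun hsum => ?_⟩
    by_cases h : γ = 0
    · exact add_pos_of_nonneg_of_pos hlin' (h3 (by simpa [h] using hsum))
    · exact add_pos_of_pos_of_nonneg (hq h).2 h2

lemma isStable_C_mul_linProd {c : ℝ} (hc : 0 < c) {s : Multiset ℝ} (hs : ∀ γ ∈ s, 0 ≤ γ) :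
    IsStable (C c * linProd s) := by
  refine ⟨by simpa using hc, fun u hu => ?_⟩
  rw [map_mul, aeval_C]
  exact mul_ne_zero (by simpa using hc.ne') (linProd_ne_zero_and_re hu s hs).1

lemma IsStable.coeff_one_nonneg {p : ℝ[X]} (hp : IsStable p) : 0 ≤ p.coeff 1 := by
  obtain ⟨s, hs, h⟩ := hp.exists_multiset
  rw [h, coeff_C_mul, linProd_coeff_one]
  exact mul_nonneg hp.1.le (Multiset.sum_nonneg hs)

lemma IsStable.re_logDeriv {p : ℝ[X]} (hp : IsStable p) {u : ℂ} (hu : 0 < u.re) :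
    0 ≤ (u * (aeval (u ^ 2) (derivative p) / aeval (u ^ 2) p)).re ∧
    (p.coeff 1 ≠ 0 → 0 < (u * (aeval (u ^ 2) (derivative p) / aeval (u ^ 2) p)).re) := by
  obtain ⟨s, hs, h⟩ := hp.exists_multiset
  have hc : (algebraMap ℝ ℂ) (p.coeff 0) ≠ 0 := by simpa using hp.1.ne'
  have h1 : aeval (u ^ 2) (derivative p) / aeval (u ^ 2) p =
      aeval (u ^ 2) (derivative (linProd s)) / aeval (u ^ 2) (linProd s) := by
    conv_lhs => rw [h]
    rw [derivative_C_mul, map_mul, map_mul, aeval_C, mul_div_mul_left _ _ hc]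
  have h2 : p.coeff 1 = p.coeff 0 * s.sum := by
    conv_lhs => rw [h]
    rw [coeff_C_mul, linProd_coeff_one]
  rw [h1, h2]
  obtain ⟨-, h3, h4⟩ := linProd_ne_zero_and_re hu s hs
  exact ⟨h3, fun hne => h4 (right_ne_zero_of_mul hne)⟩

lemma IsStable.derivative {p : ℝ[X]} (hp : IsStable p) (h1 : p.coeff 1 ≠ 0) :
    IsStable (derivative p) := by
  refine ⟨?_, fun u hu h => ?_⟩
  · rw [coeff_derivative]
    simpa using lt_of_le_of_ne hp.coeff_one_nonneg h1.symm
  · have := (hp.re_logDeriv hu).2 h1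
    simp [h] at this

lemma IsStable.C_mul {p : ℝ[X]} (hp : IsStable p) {c : ℝ} (hc : 0 < c) : IsStable (C c * p) := by
  refine ⟨by simpa using mul_pos hc hp.1, fun u hu => ?_⟩
  rw [map_mul, aeval_C]
  exact mul_ne_zero (by simpa using hc.ne') (hp.2 u hu)

/-- Stability is preserved by `X ∂ + s` for `s > 0`. -/
lemma IsStable.euler_add {p : ℝ[X]} (hp : IsStable p) {s : ℝ} (hs : 0 < s) :
    IsStable (X * Polynomial.derivative p + C s * p) := by
  refine ⟨by simpa using mul_pos hs hp.1, fun u hu h => ?_⟩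
  have hu0 : u ≠ 0 := by rintro rfl; simp at hu
  have hpu := hp.2 u hu
  have h1 := (hp.re_logDeriv hu).1
  have h2 : u * (aeval (u ^ 2) (Polynomial.derivative p) / aeval (u ^ 2) p) = -(u⁻¹ * (s : ℂ)) := by
    simp only [map_add, map_mul, aeval_X, aeval_C, coe_algebraMap] at h
    field_simp
    linear_combination h
  rw [h2, neg_re, re_mul_ofReal, inv_re] at h1
  have := normSq_pos.2 hu0
  have : 0 < u.re / normSq u * s := by positivity
  linarith

/-- Stability is preserved by `1 + ε (X ∂² + δ ∂)` for `ε, δ > 0`. -/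
lemma IsStable.bessel_add {p : ℝ[X]} (hp : IsStable p) {ε δ : ℝ} (hε : 0 < ε) (hδ : 0 < δ) :
    IsStable (p + C ε * (X * Polynomial.derivative (Polynomial.derivative p) +
      C δ * Polynomial.derivative p)) := by
  by_cases hc1 : p.coeff 1 = 0
  · obtain ⟨s, hs, h⟩ := hp.exists_multiset
    have hd : Polynomial.derivative p = 0 := by
      have h0 : s.sum = 0 := by
        have h2 : p.coeff 1 = p.coeff 0 * s.sum := by
          conv_lhs => rw [h]
          rw [coeff_C_mul, linProd_coeff_one]
        rw [hc1] at h2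
        exact (mul_eq_zero.1 h2.symm).resolve_left hp.1.ne'
      have h3 : linProd s = 1 := by
        rw [linProd]
        refine Multiset.prod_eq_one fun q hq => ?_
        obtain ⟨γ, hγ, rfl⟩ := Multiset.mem_map.1 hq
        have : γ = 0 := le_antisymm (h0 ▸ Multiset.single_le_sum hs γ hγ) (hs γ hγ)
        simp [this]
      rw [h, h3]; simp
    simpa [hd] using hp
  have hd := hp.derivative hc1
  refine ⟨?_, fun u hu h => ?_⟩
  · have h1 := hd.1
    rw [coeff_add, coeff_C_mul, coeff_add, mul_coeff_zero, coeff_X_zero, zero_mul, zero_add,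
      coeff_C_mul]
    have := hp.1
    positivity
  have hu0 : u ≠ 0 := by rintro rfl; simp at hu
  have hpu := hp.2 u hu
  have hdu := hd.2 u hu
  have h1 := (hp.re_logDeriv hu).2 hc1
  have h2 := (hd.re_logDeriv hu).1
  set A := u * (aeval (u ^ 2) (Polynomial.derivative p) / aeval (u ^ 2) p) with hA
  set B := u * (aeval (u ^ 2) (Polynomial.derivative (Polynomial.derivative p)) /
    aeval (u ^ 2) (Polynomial.derivative p)) with hB
  have hA0 : A ≠ 0 := fun h => by simp [h] at h1
  have hεc : (ε : ℂ) ≠ 0 := by exact_mod_cast hε.ne'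
  have h3 : A⁻¹ * ((ε⁻¹ : ℝ) : ℂ) + B + u⁻¹ * (δ : ℂ) = 0 := by
    simp only [map_add, map_mul, aeval_X, aeval_C, coe_algebraMap] at h
    rw [hA, hB]
    push_cast
    field_simp
    linear_combination h
  have h4 := congrArg Complex.re h3
  simp only [add_re, re_mul_ofReal, inv_re, zero_re] at h4
  have := normSq_pos.2 hu0
  have := normSq_pos.2 hA0
  have : 0 < A.re / normSq A * ε⁻¹ := by positivity
  have : 0 < u.re / normSq u * δ := by positivity
  linarith

/-- Coefficient sequences of stable polynomials, together with their pointwise limits. -/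
def stableSeq : Set (ℕ → ℝ) := closure {c | ∃ p : ℝ[X], IsStable p ∧ c = p.coeff}

lemma map_mem_stableSeq {c : ℕ → ℝ} (hc : c ∈ stableSeq) {f : (ℕ → ℝ) → ℕ → ℝ} (hf : Continuous f)
    (h : ∀ p : ℝ[X], IsStable p → ∃ q : ℝ[X], IsStable q ∧ f p.coeff = q.coeff) :
    f c ∈ stableSeq := by
  refine map_mem_closure hf hc ?_
  rintro _ ⟨p, hp, rfl⟩
  exact h p hp

lemma const_mul_mem_stableSeq {c : ℕ → ℝ} (hc : c ∈ stableSeq) {r : ℝ} (hr : 0 < r) :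
    (fun k => r * c k) ∈ stableSeq := by
  refine map_mem_stableSeq hc (f := fun c k => r * c k) (by fun_prop) fun p hp => ?_
  exact ⟨_, hp.C_mul hr, by ext k; simp⟩

lemma add_mul_mem_stableSeq {c : ℕ → ℝ} (hc : c ∈ stableSeq) {s : ℝ} (hs : 0 < s) :
    (fun k : ℕ => (k + s) * c k) ∈ stableSeq := by
  refine map_mem_stableSeq hc (f := fun c k => (k + s) * c k) (by fun_prop) fun p hp => ?_
  refine ⟨_, hp.euler_add hs, ?_⟩
  ext k
  cases k with
  | zero => simp
  | succ k =>
    rw [coeff_add, coeff_X_mul, coeff_C_mul, coeff_derivative]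
    push_cast; ring

lemma bessel_mem_stableSeq {c : ℕ → ℝ} (hc : c ∈ stableSeq) {ε δ : ℝ} (hε : 0 < ε) (hδ : 0 < δ) :
    (fun k : ℕ => c k + ε * ((k + 1) * (k + δ) * c (k + 1))) ∈ stableSeq := by
  refine map_mem_stableSeq hc (f := fun c k => c k + ε * ((k + 1) * (k + δ) * c (k + 1)))
    (by fun_prop) fun p hp => ⟨_, hp.bessel_add hε hδ, ?_⟩
  ext k
  rw [coeff_add, coeff_C_mul, coeff_add, coeff_C_mul, coeff_derivative]
  cases k with
  | zero => simp
  | succ k =>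
    rw [coeff_X_mul, coeff_derivative, coeff_derivative]
    push_cast; ring

lemma mem_stableSeq_of_tendsto {c : ℕ → ℕ → ℝ} {d : ℕ → ℝ} (hc : ∀ᶠ n in atTop, c n ∈ stableSeq)
    (h : ∀ k, Tendsto (fun n => c n k) atTop (𝓝 (d k))) : d ∈ stableSeq :=
  isClosed_closure.mem_of_tendsto (tendsto_pi_nhds.2 h) hc

lemma exp_mem_stableSeq {r : ℝ} (hr : 0 < r) :
    (fun k : ℕ => r ^ k / k.factorial) ∈ stableSeq := by
  have hlim : Tendsto (fun n : ℕ => (n : ℝ) * (r / n)) atTop (𝓝 r) := by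
    refine tendsto_const_nhds.congr' ?_
    filter_upwards [eventually_ne_atTop 0] with n hn
    field_simp
  refine mem_stableSeq_of_tendsto (.of_forall fun n => subset_closure ?_)
    (fun k => ProbabilityTheory.tendsto_choose_mul_pow_atTop k hlim)
  refine ⟨C 1 * linProd (Multiset.replicate n (r / n)), isStable_C_mul_linProd one_pos ?_, ?_⟩
  · intro γ hγ
    rw [Multiset.eq_of_mem_replicate hγ]
    positivity
  · ext k
    have : C 1 * linProd (Multiset.replicate n (r / n)) = (C 1 + C (r / n) * X) ^ n := by
      simp [linProd]
    have h2 : ((C 1 + C (r / n) * X) ^ n : ℝ[X]) = ((1 + X) ^ n : ℝ[X]).comp (C (r / n) * X) := by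
      simp
    rw [this, h2, comp_C_mul_X_coeff, coeff_one_add_X_pow]

lemma gamma_mem_stableSeq {r ν : ℝ} (hr : 0 < r) (hν : 0 < ν) :
    (fun k : ℕ => r ^ k / (k.factorial * Real.Gamma (k + ν))) ∈ stableSeq := by
  have hprod : ∀ n m : ℕ, 0 < n →
      (fun k : ℕ => (∏ j ∈ Finset.range m, ((k : ℝ) + ν + j)) * ((r / n) ^ k / k.factorial)) ∈
        stableSeq := by
    intro n m hn
    induction m with
    | zero =>
      simpa using exp_mem_stableSeq (r := r / n) (by positivity)
    | succ m ih =>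
      have := add_mul_mem_stableSeq ih (s := ν + m) (by positivity)
      convert this using 2 with k
      rw [Finset.prod_range_succ]; ring
  refine mem_stableSeq_of_tendsto (c := fun n k => ((n : ℝ) ^ ν * n.factorial)⁻¹ *
    ((∏ j ∈ Finset.range (n + 1), ((k : ℝ) + ν + j)) * ((r / n) ^ k / k.factorial))) ?_ ?_
  · filter_upwards [eventually_gt_atTop 0] with n hn
    exact const_mul_mem_stableSeq (hprod n (n + 1) hn) (by positivity)
  · intro k
    have h := ((Real.GammaSeq_tendsto_Gamma (k + ν)).inv₀
      (Real.Gamma_pos_of_pos (by positivity)).ne').mul_const (r ^ k / k.factorial)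
    have heq : (Real.Gamma (k + ν))⁻¹ * (r ^ k / k.factorial) =
        r ^ k / (k.factorial * Real.Gamma (k + ν)) := by
      field_simp
    rw [heq] at h
    refine h.congr' ?_
    filter_upwards [eventually_gt_atTop 0] with n hn
    have hn' : (0 : ℝ) < n := by exact_mod_cast hn
    rw [Real.GammaSeq, Real.rpow_add hn', Real.rpow_natCast, div_pow]
    field_simp

lemma linProd_coeff_nonneg {s : Multiset ℝ} (hs : ∀ γ ∈ s, 0 ≤ γ) (k : ℕ) :
    0 ≤ (linProd s).coeff k := by
  induction s using Multiset.induction generalizing k with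
  | empty => simp only [linProd_zero, coeff_one]; split_ifs <;> simp
  | cons γ s ih =>
    have ih := ih fun x hx => hs x (Multiset.mem_cons_of_mem hx)
    have hγ := hs γ (Multiset.mem_cons_self γ s)
    rw [linProd_cons, add_mul, one_mul, coeff_add, mul_assoc, coeff_C_mul]
    cases k with
    | zero => simp
    | succ k =>
      rw [coeff_X_mul]
      exact add_nonneg (ih _) (mul_nonneg hγ (ih _))

lemma linProd_eval_le {s : Multiset ℝ} (hs : ∀ γ ∈ s, 0 ≤ γ) {x : ℝ} (hx : 0 ≤ x) :
    0 ≤ (linProd s).eval x ∧ (linProd s).eval x ≤ Real.exp (s.sum * x) := by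
  induction s using Multiset.induction with
  | empty => simp
  | cons γ s ih =>
    obtain ⟨h1, h2⟩ := ih fun x hx => hs x (Multiset.mem_cons_of_mem hx)
    have hγ := hs γ (Multiset.mem_cons_self γ s)
    simp only [linProd_cons, eval_mul, eval_add, eval_one, eval_C, eval_X, Multiset.sum_cons]
    refine ⟨by positivity, ?_⟩
    rw [add_mul γ, Real.exp_add]
    gcongr
    rw [add_comm]
    exact Real.add_one_le_exp _

lemma linProd_coeff_mul_pow_le {s : Multiset ℝ} (hs : ∀ γ ∈ s, 0 ≤ γ) {x : ℝ} (hx : 0 ≤ x)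
    (k : ℕ) : (linProd s).coeff k * x ^ k ≤ Real.exp (s.sum * x) := by
  refine le_trans ?_ (linProd_eval_le hs hx).2
  by_cases hk : k ∈ Finset.range ((linProd s).natDegree + 1)
  · rw [eval_eq_sum_range]
    exact Finset.single_le_sum (f := fun i => (linProd s).coeff i * x ^ i)
      (fun i _ => mul_nonneg (linProd_coeff_nonneg hs i) (pow_nonneg hx i)) hk
  · rw [coeff_eq_zero_of_natDegree_lt (by simpa using hk), zero_mul]
    exact (linProd_eval_le hs hx).1

/-- Decreasing enumeration of a finite multiset of nonnegative reals. -/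
lemma exists_antitone_enumeration {s : Multiset ℝ} (hs : ∀ γ ∈ s, 0 ≤ γ) :
    ∃ (g : ℕ → ℝ) (N : ℕ), (∀ j, 0 ≤ g j) ∧ (∀ j, g j ≤ s.sum / (j + 1)) ∧ (∀ j, N ≤ j → g j = 0) ∧
      linProd s = ∏ j ∈ Finset.range N, (1 + C (g j) * X) ∧
      ∑ j ∈ Finset.range N, g j = s.sum := by
  set l := s.sort (· ≥ ·) with hl
  have hsl : (l : Multiset ℝ) = s := Multiset.sort_eq s _
  have hmem : ∀ γ ∈ l, 0 ≤ γ := fun γ h => hs γ (by rw [← hsl]; simpa using h)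
  have hsorted : l.SortedGE := (Multiset.pairwise_sort s (· ≥ ·)).sortedGE
  have hlt : ∀ j (h : j < l.length), l.getD j 0 = l[j] := fun j h => by simp [h]
  have hge : ∀ j, l.length ≤ j → l.getD j 0 = 0 := fun j h => by simp [h]
  have h0 : ∀ j, 0 ≤ l.getD j 0 := fun j => by
    rcases lt_or_ge j l.length with h | h
    · rw [hlt j h]; exact hmem _ (List.getElem_mem h)
    · rw [hge j h]
  have hanti : ∀ i j, i ≤ j → l.getD j 0 ≤ l.getD i 0 := fun i j hij => by
    rcases lt_or_ge j l.length with h | h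
    · rw [hlt j h, hlt i (hij.trans_lt h)]
      exact hsorted.antitone_get (a := ⟨i, hij.trans_lt h⟩) (b := ⟨j, h⟩) hij
    · rw [hge j h]; exact h0 i
  have hsum : ∑ j ∈ Finset.range l.length, l.getD j 0 = s.sum := by
    rw [Finset.sum_range, ← hsl, Multiset.sum_coe, ← Fin.sum_univ_getElem]
    exact Finset.sum_congr rfl fun i _ => hlt i i.2
  refine ⟨fun j => l.getD j 0, l.length, h0, fun j => ?_, hge, ?_, hsum⟩
  · rw [le_div_iff₀ (by positivity), ← hsum]
    have h1 : ∑ i ∈ Finset.range (j + 1), l.getD i 0 ≤ ∑ i ∈ Finset.range l.length, l.getD i 0 := by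
      rcases le_total (j + 1) l.length with h | h
      · exact Finset.sum_le_sum_of_subset_of_nonneg (by simpa using h) fun i _ _ => h0 i
      · refine (Finset.sum_subset (by simpa using h) fun i _ hi => hge i (by simpa using hi)).ge
    refine le_trans ?_ h1
    have := Finset.card_nsmul_le_sum (Finset.range (j + 1)) (fun i => l.getD i 0) (l.getD j 0)
      fun i hi => hanti i j (by simpa [Nat.lt_succ_iff] using hi)
    simp only [Finset.card_range, nsmul_eq_mul] at this
    push_cast at this
    linarith
  · rw [linProd, ← hsl, Multiset.map_coe, Multiset.prod_coe, ← Fin.prod_univ_getElem,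
      Finset.prod_range]
    refine Fintype.prod_equiv (finCongr (by simp)) _ _ fun i => ?_
    have hi : (i : ℕ) < l.length := by simpa using i.2
    simp [hi]

lemma norm_one_add_mul_exp_neg_sub_one_le {x : ℂ} {R : ℝ} (hx : ‖x‖ ≤ R) :
    ‖(1 + x) * exp (-x) - 1‖ ≤ (1 + (1 + R) * Real.exp R) * ‖x‖ ^ 2 := by
  have h := norm_exp_sub_sum_le_norm_mul_exp (-x) 2
  simp only [Finset.sum_range_succ, Finset.sum_range_zero, norm_neg] at h
  have hE : (1 + x) * exp (-x) - 1 = -x ^ 2 + (1 + x) * (exp (-x) - (1 - x)) := by ring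
  have h' : ‖exp (-x) - (1 - x)‖ ≤ ‖x‖ ^ 2 * Real.exp R := by
    refine le_trans (le_of_eq ?_) (h.trans (by gcongr))
    congr 1; simp; ring
  have h1 : ‖1 + x‖ ≤ 1 + R := (norm_add_le _ _).trans (by simpa using hx)
  have hR : 0 ≤ R := (norm_nonneg x).trans hx
  rw [hE]
  refine (norm_add_le _ _).trans ?_
  rw [norm_neg, norm_pow, norm_mul]
  calc ‖x‖ ^ 2 + ‖1 + x‖ * ‖exp (-x) - (1 - x)‖
      ≤ ‖x‖ ^ 2 + (1 + R) * (‖x‖ ^ 2 * Real.exp R) := by gcongr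
    _ = _ := by ring

lemma tprod_one_add_mul_exp_neg {γ : ℕ → ℝ} (hγ : Summable γ) (w : ℂ) :
    ∏' j, (1 + (γ j : ℂ) * w) * exp (-((γ j : ℂ) * w)) =
      (∏' j, (1 + (γ j : ℂ) * w)) * exp (-(((∑' j, γ j : ℝ) : ℂ) * w)) := by
  have hs : HasSum (fun j => -((γ j : ℂ) * w)) (-(((∑' j, γ j : ℝ) : ℂ) * w)) :=
    ((hasSum_ofReal.2 hγ.hasSum).mul_right w).neg
  have h1 : Multipliable fun j => 1 + (γ j : ℂ) * w :=
    multipliable_one_add_of_summable (by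
      simpa [norm_mul] using (hγ.norm.mul_right ‖w‖))
  have h2 := hs.cexp
  rw [← h2.tprod_eq]
  exact h1.tprod_mul h2.multipliable

lemma one_le_norm_tprod {γ : ℕ → ℝ} (hγ0 : ∀ j, 0 ≤ γ j) (hγ : Summable γ) {x : ℝ} (hx : 0 ≤ x) :
    1 ≤ ‖∏' j, (1 + (γ j : ℂ) * (x : ℂ))‖ := by
  have h1 : Multipliable fun j => 1 + (γ j : ℂ) * (x : ℂ) :=
    multipliable_one_add_of_summable (by
      simpa [norm_mul] using (hγ.norm.mul_right ‖(x : ℂ)‖))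
  refine ge_of_tendsto' h1.hasProd.norm fun s => ?_
  refine Finset.one_le_prod fun j _ => ?_
  have := mul_nonneg (hγ0 j) hx
  rw [show 1 + (γ j : ℂ) * (x : ℂ) = ((1 + γ j * x : ℝ) : ℂ) by push_cast; rfl, norm_real,
    Real.norm_of_nonneg (by linarith)]
  linarith

/-- A power series whose coefficients are limits of those of stable polynomials sums to
`C e^{α w} ∏ (1 + γ_j w)`. -/
theorem exists_tsum_eq_exp_mul_tprod {c : ℕ → ℝ} (hc : c ∈ stableSeq) (h0 : 0 < c 0) :
    ∃ (α : ℝ) (γ : ℕ → ℝ), 0 ≤ α ∧ (∀ j, 0 ≤ γ j) ∧ Summable γ ∧ ∀ w : ℂ,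
      ∑' k, (c k : ℂ) * w ^ k = c 0 * (exp (α * w) * ∏' j, (1 + (γ j : ℂ) * w)) := by
  obtain ⟨x, hx, hlim⟩ := mem_closure_iff_seq_limit.1 hc
  choose p hp hxp using hx
  choose s hs hps using fun n => (hp n).exists_multiset
  choose g N hg0 hgle hgN hgprod hgsum using fun n => exists_antitone_enumeration (hs n)
  have hcoef : ∀ k, Tendsto (fun n => (p n).coeff k) atTop (𝓝 (c k)) := fun k => by
    simpa [hxp] using tendsto_pi_nhds.1 hlim k
  have hsum : ∀ n, (s n).sum = (p n).coeff 1 / (p n).coeff 0 := fun n => by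
    rw [eq_div_iff (hp n).1.ne', mul_comm]
    conv_rhs => rw [hps n]
    rw [coeff_C_mul, linProd_coeff_one]
  set S := c 1 / c 0 with hS
  have hsumlim : Tendsto (fun n => (s n).sum) atTop (𝓝 S) := by
    simp_rw [hsum]; exact (hcoef 1).div (hcoef 0) h0.ne'
  have hM : ∀ᶠ n in atTop, (s n).sum ≤ S + 1 :=
    hsumlim.eventually_le_const (by linarith)
  have hgM : ∀ n, (s n).sum ≤ S + 1 → ∀ j, g n j ≤ (S + 1) / (j + 1) := fun n hn j =>
    (hgle n j).trans (by gcongr)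
  obtain ⟨γ, hγmem, φ, hφ, hγlim⟩ := (isCompact_univ_pi fun j : ℕ =>
    isCompact_Icc (a := (0 : ℝ)) (b := (S + 1) / (j + 1))).tendsto_subseq' (x := g)
    (hM.mono fun n hn => fun j _ => ⟨hg0 n j, hgM n hn j⟩).frequently
  have hγlim' : ∀ j, Tendsto (fun n => g (φ n) j) atTop (𝓝 (γ j)) := tendsto_pi_nhds.1 hγlim
  have hγ0 : ∀ j, 0 ≤ γ j := fun j => (hγmem j trivial).1
  have hS0 : 0 ≤ S + 1 := by
    obtain ⟨n, hn⟩ := hM.exists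
    exact (Multiset.sum_nonneg (hs n)).trans hn
  have hpart : ∀ n, ∑ j ∈ Finset.range n, γ j ≤ S := fun n => by
    refine le_of_tendsto_of_tendsto' (tendsto_finsetSum _ fun j _ => hγlim' j)
      (hsumlim.comp hφ.tendsto_atTop) fun m => ?_
    rw [Function.comp, ← hgsum]
    have h1 : ∑ j ∈ Finset.range n, g (φ m) j ≤
        ∑ j ∈ Finset.range (max n (N (φ m))), g (φ m) j :=
      Finset.sum_le_sum_of_subset_of_nonneg (by simp) fun i _ _ => hg0 _ i
    refine h1.trans (Finset.sum_subset (by simp) fun i _ hi => hgN _ i (by simpa using hi)).ge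
  have hγsum : Summable γ := summable_of_sum_range_le hγ0 hpart
  refine ⟨S - ∑' j, γ j, γ, sub_nonneg.2 (hγsum.tsum_le_of_sum_range_le hpart), hγ0, hγsum,
    fun w => ?_⟩
  -- limits of the values, computed from the coefficients and from the factorizations
  have hleft : Tendsto (fun n => aeval w (p n)) atTop (𝓝 (∑' k, (c k : ℂ) * w ^ k)) := by
    set Y := ‖w‖ + 1 with hY
    have hY0 : 0 < Y := by positivity
    have hser : ∀ n, aeval w (p n) = ∑' k, ((p n).coeff k : ℂ) * w ^ k := fun n => by
      rw [aeval_eq_sum_range, tsum_eq_sum (s := Finset.range ((p n).natDegree + 1))]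
      · simp [Algebra.smul_def]
      · intro k hk
        rw [coeff_eq_zero_of_natDegree_lt (by simpa using hk)]; simp
    simp_rw [hser]
    refine tendsto_tsum_of_dominated_convergence
      (bound := fun k => (c 0 + 1) * Real.exp ((S + 1) * Y) * (‖w‖ / Y) ^ k) ?_ ?_ ?_
    · refine (summable_geometric_of_lt_one (by positivity) ?_).mul_left _
      rw [div_lt_one hY0]; linarith
    · exact fun k => ((continuous_ofReal.tendsto _).comp (hcoef k)).mul_const _
    · filter_upwards [hM, (hcoef 0).eventually_le_const (show c 0 < c 0 + 1 by linarith)]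
        with n hn hn0 k
      have hlin := linProd_coeff_mul_pow_le (hs n) hY0.le k
      have hpos := linProd_coeff_nonneg (hs n) k
      have hk : (p n).coeff k = (p n).coeff 0 * (linProd (s n)).coeff k := by
        conv_lhs => rw [hps n]
        rw [coeff_C_mul]
      have hp0 := (hp n).1
      rw [norm_mul, norm_real, norm_pow, hk, Real.norm_of_nonneg (by positivity), div_pow,
        mul_div_assoc', le_div_iff₀ (by positivity)]
      calc (p n).coeff 0 * (linProd (s n)).coeff k * ‖w‖ ^ k * Y ^ k
          = (p n).coeff 0 * ((linProd (s n)).coeff k * Y ^ k) * ‖w‖ ^ k := by ring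
        _ ≤ (c 0 + 1) * Real.exp ((S + 1) * Y) * ‖w‖ ^ k := by
            gcongr
            exact hlin.trans (by gcongr)
  have hprod : Tendsto (fun n => ∏' j, (1 + ((1 + (g (φ n) j : ℂ) * w) *
      exp (-((g (φ n) j : ℂ) * w)) - 1))) atTop
      (𝓝 (∏' j, (1 + ((1 + (γ j : ℂ) * w) * exp (-((γ j : ℂ) * w)) - 1)))) := by
    set R := (S + 1) * ‖w‖ with hR
    refine tendsto_tprod_one_add_of_dominated_convergence
      (bound := fun j : ℕ => (1 + (1 + R) * Real.exp R) * (R ^ 2 * (1 / ((j : ℝ) + 1) ^ 2)))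
      ?_ ?_ ?_
    · have h := (summable_nat_add_iff 1).2 (Real.summable_one_div_nat_pow.2 one_lt_two)
      push_cast at h
      exact (h.mul_left _).mul_left _
    · intro j
      have h := ((continuous_ofReal.tendsto _).comp (hγlim' j)).mul_const w
      exact ((h.const_add 1).mul ((continuous_exp.tendsto _).comp h.neg)).sub_const 1
    · filter_upwards [hφ.tendsto_atTop.eventually hM] with n hn j
      have hR0 : 0 ≤ R := by positivity
      have hle : ‖(g (φ n) j : ℂ) * w‖ ≤ R * (1 / ((j : ℝ) + 1)) := by
        rw [norm_mul, norm_real, Real.norm_of_nonneg (hg0 _ _)]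
        calc _ ≤ (S + 1) / (j + 1) * ‖w‖ := by gcongr; exact hgM _ hn j
          _ = _ := by rw [hR]; ring
      have hle' : ‖(g (φ n) j : ℂ) * w‖ ≤ R := hle.trans (mul_le_of_le_one_right hR0 (by
        rw [div_le_one (by positivity)]; linarith [Nat.cast_nonneg (α := ℝ) j]))
      refine (norm_one_add_mul_exp_neg_sub_one_le hle').trans ?_
      gcongr
      calc ‖(g (φ n) j : ℂ) * w‖ ^ 2 ≤ (R * (1 / ((j : ℝ) + 1))) ^ 2 := by gcongr
        _ = _ := by rw [mul_pow, div_pow, one_pow]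
  have hval : ∀ n, aeval w (p n) = (p n).coeff 0 * (exp ((s n).sum * w) *
      ∏' j, (1 + ((1 + (g n j : ℂ) * w) * exp (-((g n j : ℂ) * w)) - 1))) := fun n => by
    have h1 : ∏' j, (1 + ((1 + (g n j : ℂ) * w) * exp (-((g n j : ℂ) * w)) - 1)) =
        ∏ j ∈ Finset.range (N n), ((1 + (g n j : ℂ) * w) * exp (-((g n j : ℂ) * w))) := by
      rw [tprod_eq_prod (s := Finset.range (N n))]
      · exact Finset.prod_congr rfl fun j _ => by ring
      · intro j hj
        simp [hgN n j (by simpa using hj)]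
    have h2 : ∏ j ∈ Finset.range (N n), exp (-((g n j : ℂ) * w)) = exp (-((s n).sum * w)) := by
      rw [← exp_sum, ← hgsum n]
      push_cast
      rw [Finset.sum_neg_distrib, Finset.sum_mul]
    have h3 : aeval w (linProd (s n)) = ∏ j ∈ Finset.range (N n), (1 + (g n j : ℂ) * w) := by
      rw [hgprod n, map_prod]
      simp
    rw [h1, Finset.prod_mul_distrib, h2, ← h3, mul_comm (aeval w _), ← mul_assoc (exp _),
      ← exp_add, add_neg_cancel, exp_zero, one_mul]
    conv_lhs => rw [hps n]
    rw [map_mul, aeval_C]; rfl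
  have hright := ((continuous_ofReal.tendsto _).comp ((hcoef 0).comp hφ.tendsto_atTop)).mul
    (((continuous_exp.tendsto _).comp (((continuous_ofReal.tendsto _).comp
      (hsumlim.comp hφ.tendsto_atTop)).mul_const w)).mul hprod)
  refine (tendsto_nhds_unique (hleft.comp hφ.tendsto_atTop)
    (hright.congr fun n => (hval (φ n)).symm)).trans ?_
  simp_rw [add_sub_cancel]
  rw [tprod_one_add_mul_exp_neg hγsum, mul_comm (∏' j, _), ← mul_assoc (exp _), ← exp_add]
  congr 3
  push_cast; ring_nf

/-- If the coefficients decay fast enough, no exponential factor is present. -/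
theorem exists_tsum_eq_tprod {c : ℕ → ℝ} (hc : c ∈ stableSeq) (h0 : 0 < c 0)
    (hdecay : ∀ ε > 0, ∃ K : ℝ, ∀ k, |c k| ≤ K * (ε ^ k / k.factorial)) :
    ∃ γ : ℕ → ℝ, (∀ j, 0 ≤ γ j) ∧ Summable γ ∧ ∀ w : ℂ,
      ∑' k, (c k : ℂ) * w ^ k = c 0 * ∏' j, (1 + (γ j : ℂ) * w) := by
  obtain ⟨α, γ, hα, hγ0, hγ, h⟩ := exists_tsum_eq_exp_mul_tprod hc h0
  rcases hα.eq_or_lt with rfl | hα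
  · exact ⟨γ, hγ0, hγ, fun w => by simpa using h w⟩
  exfalso
  obtain ⟨K, hK⟩ := hdecay (α / 2) (by linarith)
  have hub : ∀ x : ℝ, 0 ≤ x → c 0 * Real.exp (α / 2 * x) ≤ K := fun x hx => by
    have h1 : ‖∑' k, (c k : ℂ) * (x : ℂ) ^ k‖ ≤ K * Real.exp (α / 2 * x) := by
      refine tsum_of_norm_bounded (g := fun k => K * ((α / 2 * x) ^ k / k.factorial)) ?_ fun k => ?_
      · have := NormedSpace.expSeries_div_hasSum_exp (α / 2 * x)
        rw [← Real.exp_eq_exp_ℝ] at this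
        exact this.mul_left K
      · rw [norm_mul, norm_real, norm_pow, norm_real, Real.norm_eq_abs, Real.norm_of_nonneg hx,
          mul_pow]
        calc |c k| * x ^ k ≤ K * ((α / 2) ^ k / k.factorial) * x ^ k := by gcongr; exact hK k
          _ = _ := by ring
    rw [h x, norm_mul, norm_mul, norm_real, Real.norm_of_nonneg h0.le, norm_exp] at h1
    have h2 := one_le_norm_tprod hγ0 hγ hx
    have h3 : ((α : ℂ) * x).re = α / 2 * x + α / 2 * x := by
      rw [← ofReal_mul, ofReal_re]; ring
    rw [h3, Real.exp_add] at h1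
    have h4 : 0 < Real.exp (α / 2 * x) := Real.exp_pos _
    refine le_of_mul_le_mul_right (le_trans ?_ h1) h4
    calc c 0 * Real.exp (α / 2 * x) * Real.exp (α / 2 * x)
        = c 0 * (Real.exp (α / 2 * x) * Real.exp (α / 2 * x) * 1) := by ring
      _ ≤ _ := by gcongr
  have htend : Tendsto (fun x : ℝ => c 0 * Real.exp (α / 2 * x)) atTop atTop :=
    (Real.tendsto_exp_atTop.comp (tendsto_id.const_mul_atTop (by linarith))).const_mul_atTop h0
  obtain ⟨x, hx, hx'⟩ := ((eventually_ge_atTop 0).and (htend.eventually_gt_atTop K)).exists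
  exact absurd (hub x hx) (not_le.2 hx')

lemma integral_rpow_mul_one_sub_pow {R : ℝ} (hR : 0 < R) (n : ℕ) {s : ℝ} (hs : 0 < s) :
    ∫ t in (0 : ℝ)..R, t ^ (s - 1) * (1 - R⁻¹ * t) ^ n =
      R ^ s * n.factorial * Real.Gamma s / Real.Gamma (s + n + 1) := by
  have hInt : ∀ (n : ℕ) {s : ℝ}, 0 < s →
      IntervalIntegrable (fun t : ℝ => t ^ (s - 1) * (1 - R⁻¹ * t) ^ n) volume 0 R :=
    fun n s hs => (intervalIntegral.intervalIntegrable_rpow' (by linarith)).mul_continuousOn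
      (by fun_prop)
  induction n generalizing s with
  | zero =>
    have h0 := (Real.Gamma_pos_of_pos hs).ne'
    simp only [pow_zero, mul_one, Nat.factorial_zero, Nat.cast_one, Nat.cast_zero, add_zero]
    rw [integral_rpow (Or.inl (by linarith)), Real.Gamma_add_one hs.ne', sub_add_cancel,
      Real.zero_rpow hs.ne']
    field_simp
    simp
  | succ n ih =>
    have hsplit : ∫ t in (0 : ℝ)..R, t ^ (s - 1) * (1 - R⁻¹ * t) ^ (n + 1) =
        (∫ t in (0 : ℝ)..R, t ^ (s - 1) * (1 - R⁻¹ * t) ^ n) -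
          R⁻¹ * ∫ t in (0 : ℝ)..R, t ^ (s + 1 - 1) * (1 - R⁻¹ * t) ^ n := by
      rw [← intervalIntegral.integral_const_mul, ← intervalIntegral.integral_sub (hInt n hs)
        ((hInt n (by linarith)).const_mul _)]
      refine intervalIntegral.integral_congr_ae (.of_forall fun t ht => ?_)
      rw [Set.uIoc_of_le hR.le] at ht
      have : t ^ (s + 1 - 1) = t ^ (s - 1) * t := by
        rw [← Real.rpow_add_one ht.1.ne']; congr 1; ring
      rw [this]; ring
    have h1 : 0 < s + n + 1 := by positivity
    have h2 := (Real.Gamma_pos_of_pos h1).ne'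
    rw [hsplit, ih hs, ih (by linarith : 0 < s + 1), Real.Gamma_add_one hs.ne',
      show s + 1 + (n : ℝ) + 1 = s + n + 1 + 1 by ring,
      show s + ((n + 1 : ℕ) : ℝ) + 1 = s + n + 1 + 1 by push_cast; ring,
      Real.Gamma_add_one h1.ne', Real.rpow_add_one hR.ne', Nat.factorial_succ]
    push_cast
    field_simp
    ring

lemma Gamma_natCast_succ_add {δ : ℝ} (hδ : 0 < δ) (k : ℕ) :
    Real.Gamma ((k + 1 : ℕ) + δ) = (k + δ) * Real.Gamma (k + δ) := by
  rw [← Real.Gamma_add_one (by positivity)]; congr 1; push_cast; ring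

lemma moment_one_sub_pow_mem_stableSeq {R δ : ℝ} (hR : 0 < R) (hδ : 0 < δ) (n : ℕ) :
    (fun k : ℕ => (∫ t in (0 : ℝ)..R, t ^ (k + δ - 1) * (1 - R⁻¹ * t) ^ n) /
      (k.factorial * Real.Gamma (k + δ))) ∈ stableSeq := by
  convert const_mul_mem_stableSeq (gamma_mem_stableSeq hR (ν := δ + n + 1) (by positivity))
    (r := R ^ δ * n.factorial) (by positivity) using 2 with k
  have hk : 0 < k + δ := by positivity
  have h1 := (Real.Gamma_pos_of_pos hk).ne'
  rw [integral_rpow_mul_one_sub_pow hR n hk, Real.rpow_add hR, Real.rpow_natCast,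
    show (k : ℝ) + (δ + n + 1) = k + δ + n + 1 by ring]
  have h2 := (Real.Gamma_pos_of_pos (by positivity : 0 < k + δ + n + 1)).ne'
  field_simp

lemma moment_mul_one_add_mem_stableSeq {R δ y : ℝ} (hR : 0 < R) (hδ : 0 < δ) (hy : 0 < y)
    {q : ℝ → ℝ} (hq : Continuous q)
    (h : (fun k : ℕ => (∫ t in (0 : ℝ)..R, t ^ (k + δ - 1) * q t) /
      (k.factorial * Real.Gamma (k + δ))) ∈ stableSeq) :
    (fun k : ℕ => (∫ t in (0 : ℝ)..R, t ^ (k + δ - 1) * (q t * (1 + y * t))) /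
      (k.factorial * Real.Gamma (k + δ))) ∈ stableSeq := by
  convert bessel_mem_stableSeq h hy hδ using 2 with k
  have hInt : ∀ k : ℕ,
      IntervalIntegrable (fun t : ℝ => t ^ (k + δ - 1) * q t) volume 0 R :=
    fun k => (intervalIntegral.intervalIntegrable_rpow' (by
      have : (0 : ℝ) ≤ k := by positivity
      linarith)).mul_continuousOn hq.continuousOn
  have hsplit : ∫ t in (0 : ℝ)..R, t ^ (k + δ - 1) * (q t * (1 + y * t)) =
      (∫ t in (0 : ℝ)..R, t ^ (k + δ - 1) * q t) +
        y * ∫ t in (0 : ℝ)..R, t ^ ((k + 1 : ℕ) + δ - 1) * q t := by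
    rw [← intervalIntegral.integral_const_mul, ← intervalIntegral.integral_add (hInt k)
      ((hInt (k + 1)).const_mul _)]
    refine intervalIntegral.integral_congr_ae (.of_forall fun t ht => ?_)
    rw [Set.uIoc_of_le hR.le] at ht
    have : t ^ ((k + 1 : ℕ) + δ - 1) = t ^ (k + δ - 1) * t := by
      rw [← Real.rpow_add_one ht.1.ne']; congr 1; push_cast; ring
    rw [this]; ring
  have hk : 0 < k + δ := by positivity
  have h1 := (Real.Gamma_pos_of_pos hk).ne'
  rw [hsplit, Gamma_natCast_succ_add hδ, Nat.factorial_succ]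
  push_cast
  field_simp

lemma moment_pow_mul_pow_mem_stableSeq {R δ y : ℝ} (hR : 0 < R) (hδ : 0 < δ) (hy : 0 < y)
    (n m : ℕ) :
    (fun k : ℕ => (∫ t in (0 : ℝ)..R, t ^ (k + δ - 1) * ((1 - R⁻¹ * t) ^ n * (1 + y * t) ^ m)) /
      (k.factorial * Real.Gamma (k + δ))) ∈ stableSeq := by
  induction m with
  | zero => simpa using moment_one_sub_pow_mem_stableSeq hR hδ n
  | succ m ih =>
    simp_rw [pow_succ (1 + y * _), ← mul_assoc ((1 - R⁻¹ * _) ^ n)]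
    exact moment_mul_one_add_mem_stableSeq hR hδ hy (by fun_prop) ih

lemma exists_exp_quadratic_le (a : ℝ) {b : ℝ} (hb : 0 < b) (r : ℝ) :
    ∃ K > 0, ∀ t : ℝ, Real.exp (-(a * t + b * t ^ 2)) ≤ K * Real.exp (-(r * t)) := by
  refine ⟨Real.exp ((r - a) ^ 2 / (4 * b)), Real.exp_pos _, fun t => ?_⟩
  rw [← Real.exp_add, Real.exp_le_exp]
  have : (r - a) ^ 2 / (4 * b) + -(r * t) + (a * t + b * t ^ 2) =
      b * (t - (r - a) / (2 * b)) ^ 2 := by field_simp; ring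
  nlinarith [mul_nonneg hb.le (sq_nonneg (t - (r - a) / (2 * b)))]

lemma integrableOn_rpow_mul_exp_quadratic (a : ℝ) {b s : ℝ} (hb : 0 < b) (hs : 0 < s) :
    IntegrableOn (fun t : ℝ => t ^ (s - 1) * Real.exp (-(a * t + b * t ^ 2))) (Set.Ioi 0) := by
  obtain ⟨K, hK, h⟩ := exists_exp_quadratic_le a hb 1
  have h1 := ((Real.GammaIntegral_convergent hs).const_mul K)
  refine Integrable.mono' h1 (by fun_prop) ?_
  filter_upwards [self_mem_ae_restrict measurableSet_Ioi] with t ht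
  have ht : 0 < t := ht
  rw [Real.norm_of_nonneg (by positivity)]
  calc _ ≤ t ^ (s - 1) * (K * Real.exp (-(1 * t))) := by gcongr; exact h t
    _ = _ := by rw [one_mul]; ring

/-- Normalized moments of the radial part of the `φ⁴` weight. -/
def phiCoeff (a b δ : ℝ) (k : ℕ) : ℝ :=
  (∫ t in Set.Ioi (0 : ℝ), t ^ (k + δ - 1) * Real.exp (-(a * t + b * t ^ 2))) /
    (k.factorial * Real.Gamma (k + δ))

lemma phiCoeff_mem_stableSeq (a : ℝ) {b δ : ℝ} (hb : 0 < b) (hδ : 0 < δ) :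
    phiCoeff a b δ ∈ stableSeq := by
  set x : ℕ → ℝ := fun n => (a / n + √((a / n) ^ 2 + 4 * (b / n))) / 2 with hx
  set y : ℕ → ℝ := fun n => x n - a / n with hy
  have hxy : ∀ n : ℕ, 0 < n → 0 < x n ∧ 0 < y n ∧ x n * y n = b / n := fun n hn => by
    have hn' : (0 : ℝ) < n := by exact_mod_cast hn
    have hbn : 0 < b / n := by positivity
    have hsq := Real.sq_sqrt (show 0 ≤ (a / n) ^ 2 + 4 * (b / n) by positivity)
    have habs : |a / n| < √((a / n) ^ 2 + 4 * (b / n)) := by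
      rw [← Real.sqrt_sq_eq_abs]
      exact Real.sqrt_lt_sqrt (sq_nonneg _) (by linarith)
    obtain ⟨h1, h2⟩ := abs_lt.1 habs
    refine ⟨by simp only [hx]; linarith, by simp only [hy, hx]; linarith, ?_⟩
    simp only [hy, hx]
    nlinarith
  have hx0 : Tendsto x atTop (𝓝 0) := by
    have h1 : ∀ c : ℝ, Tendsto (fun n : ℕ => c / n) atTop (𝓝 0) :=
      fun c => tendsto_const_div_atTop_nhds_zero_nat c
    have := (((h1 a).add ((((h1 a).pow 2).add ((h1 b).const_mul 4)).sqrt)).div_const 2)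
    simpa using this
  have hfac : ∀ n : ℕ, 0 < n → ∀ t : ℝ,
      (1 - x n * t) * (1 + y n * t) = 1 - (a * t + b * t ^ 2) / n := fun n hn t => by
    have h := (hxy n hn).2.2
    have h2 : x n - y n = a / n := by simp only [hy]; ring
    calc _ = 1 - (x n - y n) * t - (x n * y n) * t ^ 2 := by ring
      _ = _ := by rw [h, h2]; ring
  refine mem_stableSeq_of_tendsto (c := fun n k =>
    (∫ t in (0 : ℝ)..(x n)⁻¹, t ^ (k + δ - 1) *
      ((1 - (x n)⁻¹⁻¹ * t) ^ n * (1 + y n * t) ^ n)) / (k.factorial * Real.Gamma (k + δ))) ?_ ?_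
  · filter_upwards [eventually_gt_atTop 0] with n hn
    obtain ⟨h1, h2, -⟩ := hxy n hn
    exact moment_pow_mul_pow_mem_stableSeq (inv_pos.2 h1) hδ h2 n n
  intro k
  refine Tendsto.div_const ?_ _
  have hk : 0 < k + δ := by positivity
  have hev : ∀ᶠ n : ℕ in atTop, ∫ t in Set.Ioi (0 : ℝ), (Set.Iic (x n)⁻¹).indicator
      (fun t => t ^ (k + δ - 1) * (1 - (a * t + b * t ^ 2) / n) ^ n) t =
      ∫ t in (0 : ℝ)..(x n)⁻¹, t ^ (k + δ - 1) *
        ((1 - (x n)⁻¹⁻¹ * t) ^ n * (1 + y n * t) ^ n) := by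
    filter_upwards [eventually_gt_atTop 0] with n hn
    rw [setIntegral_indicator measurableSet_Iic, Set.Ioi_inter_Iic,
      intervalIntegral.integral_of_le (inv_pos.2 (hxy n hn).1).le]
    simp_rw [inv_inv, ← mul_pow, hfac n hn]
  refine Tendsto.congr' hev ?_
  refine tendsto_integral_filter_of_dominated_convergence
    (fun t => t ^ (k + δ - 1) * Real.exp (-(a * t + b * t ^ 2))) ?_ ?_
    (integrableOn_rpow_mul_exp_quadratic a hb hk) ?_
  · refine .of_forall fun n => ?_
    refine AEStronglyMeasurable.indicator ?_ measurableSet_Iic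
    exact Measurable.aestronglyMeasurable (by fun_prop)
  · filter_upwards [eventually_gt_atTop 0] with n hn
    filter_upwards [self_mem_ae_restrict measurableSet_Ioi] with t ht
    have ht : 0 < t := ht
    by_cases htx : t ∈ Set.Iic (x n)⁻¹
    · obtain ⟨h1, h2, -⟩ := hxy n hn
      have hn' : (0 : ℝ) < n := by exact_mod_cast hn
      have h3 : 0 ≤ 1 - x n * t := by
        have : x n * t ≤ x n * (x n)⁻¹ := by gcongr; exact htx
        rw [mul_inv_cancel₀ h1.ne'] at this
        linarith
      have h4 : 0 ≤ 1 - (a * t + b * t ^ 2) / n := by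
        rw [← hfac n hn]; positivity
      rw [Set.indicator_of_mem htx, Real.norm_of_nonneg (by positivity)]
      gcongr
      refine Real.one_sub_div_pow_le_exp_neg ?_
      rwa [sub_nonneg, div_le_one hn'] at h4
    · rw [Set.indicator_of_notMem htx, norm_zero]
      positivity
  · filter_upwards [self_mem_ae_restrict measurableSet_Ioi] with t ht
    have ht : 0 < t := ht
    have hlim := (Real.tendsto_one_add_div_pow_exp (-(a * t + b * t ^ 2))).const_mul
      (t ^ (k + δ - 1))
    refine hlim.congr' ?_
    filter_upwards [eventually_gt_atTop 0, hx0.eventually_lt_const (inv_pos.2 ht)] with n hn hnx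
    have hmem : t ∈ Set.Iic (x n)⁻¹ := by
      rw [Set.mem_Iic, le_inv_comm₀ ht (hxy n hn).1]
      exact hnx.le
    rw [Set.indicator_of_mem hmem, neg_div, ← sub_eq_add_neg]

lemma phiCoeff_zero_pos (a : ℝ) {b δ : ℝ} (hb : 0 < b) (hδ : 0 < δ) : 0 < phiCoeff a b δ 0 := by
  have hG := Real.Gamma_pos_of_pos hδ
  have hInt := integrableOn_rpow_mul_exp_quadratic a hb hδ
  have : 0 < ∫ t in Set.Ioi (0 : ℝ), t ^ (δ - 1) * Real.exp (-(a * t + b * t ^ 2)) := by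
    rw [setIntegral_pos_iff_support_of_nonneg_ae _ hInt]
    · refine lt_of_lt_of_le (b := volume (Set.Ioi (0 : ℝ))) (by simp) (measure_mono fun t ht => ?_)
      have ht' : 0 < t := ht
      exact ⟨by rw [Function.mem_support]; positivity, ht⟩
    · filter_upwards [self_mem_ae_restrict measurableSet_Ioi] with t ht
      have ht : 0 < t := ht
      show 0 ≤ _
      positivity
  simp only [phiCoeff, Nat.cast_zero, zero_add, Nat.factorial_zero, Nat.cast_one, one_mul]
  positivity

lemma integrableOn_rpow_mul_exp_neg_mul {s r : ℝ} (hs : 0 < s) (hr : 0 < r) :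
    IntegrableOn (fun t : ℝ => t ^ (s - 1) * Real.exp (-(r * t))) (Set.Ioi 0) := by
  simpa using integrableOn_rpow_mul_exp_neg_mul_rpow (s := s - 1) (p := 1) (b := r)
    (by linarith) one_pos hr

lemma phiCoeff_decay (a : ℝ) {b δ : ℝ} (hb : 0 < b) (hδ : 0 < δ) {ε : ℝ} (hε : 0 < ε) :
    ∃ K : ℝ, ∀ k, |phiCoeff a b δ k| ≤ K * (ε ^ k / k.factorial) := by
  obtain ⟨K, hK, h⟩ := exists_exp_quadratic_le a hb ε⁻¹
  refine ⟨K * ε ^ δ, fun k => ?_⟩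
  have hk : 0 < k + δ := by positivity
  have hG := Real.Gamma_pos_of_pos hk
  have h0 : 0 ≤ ∫ t in Set.Ioi (0 : ℝ), t ^ (k + δ - 1) * Real.exp (-(a * t + b * t ^ 2)) :=
    setIntegral_nonneg measurableSet_Ioi fun t ht => by
      have ht : 0 < t := ht
      positivity
  have hI := Real.integral_rpow_mul_exp_neg_mul_Ioi hk (inv_pos.2 hε)
  have hInt := integrableOn_rpow_mul_exp_neg_mul hk (inv_pos.2 hε)
  have hle : ∫ t in Set.Ioi (0 : ℝ), t ^ (k + δ - 1) * Real.exp (-(a * t + b * t ^ 2)) ≤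
      K * (ε ^ (k + δ) * Real.Gamma (k + δ)) := by
    rw [one_div, inv_inv] at hI
    rw [← hI, ← integral_const_mul]
    refine setIntegral_mono_on (integrableOn_rpow_mul_exp_quadratic a hb hk) (hInt.const_mul K)
      measurableSet_Ioi fun t ht => ?_
    have ht : 0 < t := ht
    calc _ ≤ t ^ (k + δ - 1) * (K * Real.exp (-(ε⁻¹ * t))) := by gcongr; exact h t
      _ = _ := by ring
  rw [phiCoeff, abs_of_nonneg (by positivity), div_le_iff₀ (by positivity)]
  refine hle.trans (le_of_eq ?_)
  rw [Real.rpow_add hε, Real.rpow_natCast]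
  field_simp

/-- The Gamma integral with a complex rate. -/
lemma integral_rpow_mul_cexp_neg_mul {s : ℝ} (hs : 0 < s) {z : ℂ} (hz : 0 < z.re) :
    ∫ t in Set.Ioi (0 : ℝ), ((t ^ (s - 1) : ℝ) : ℂ) * exp (-(z * t)) =
      (1 / z) ^ (s : ℂ) * Real.Gamma s := by
  set μ : Measure ℝ := (volume.restrict (Set.Ioi 0)).withDensity
    fun t => ENNReal.ofReal (t ^ (s - 1)) with hμ
  have hmeas : Measurable fun t : ℝ => ENNReal.ofReal (t ^ (s - 1)) := by fun_prop
  have hfin : ∀ᵐ t ∂(volume.restrict (Set.Ioi (0 : ℝ))), ENNReal.ofReal (t ^ (s - 1)) < ⊤ :=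
    .of_forall fun _ => ENNReal.ofReal_lt_top
  have hset : Set.Iio 0 ⊆ ProbabilityTheory.integrableExpSet id μ := fun x hx => by
    have hx : x < 0 := hx
    rw [ProbabilityTheory.integrableExpSet, Set.mem_ofPred_eq, hμ,
      integrable_withDensity_iff_integrable_smul' hmeas hfin]
    refine (integrableOn_rpow_mul_exp_neg_mul hs (neg_pos.2 hx)).congr ?_
    filter_upwards [self_mem_ae_restrict measurableSet_Ioi] with t ht
    have ht : 0 < t := ht
    rw [ENNReal.toReal_ofReal (by positivity)]
    simp
  have hF : ∀ w : ℂ, ProbabilityTheory.complexMGF id μ w =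
      ∫ t in Set.Ioi (0 : ℝ), ((t ^ (s - 1) : ℝ) : ℂ) * exp (w * t) := fun w => by
    rw [ProbabilityTheory.complexMGF, hμ, integral_withDensity_eq_integral_toReal_smul hmeas hfin]
    refine setIntegral_congr_fun measurableSet_Ioi fun t ht => ?_
    have ht : 0 < t := ht
    simp only [id]
    rw [ENNReal.toReal_ofReal (by positivity), real_smul]
  have hopen : IsOpen {w : ℂ | w.re < 0} := isOpen_lt continuous_re continuous_const
  have hA : AnalyticOnNhd ℂ (ProbabilityTheory.complexMGF id μ) {w | w.re < 0} :=
    ProbabilityTheory.analyticOnNhd_complexMGF.mono fun w hw =>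
      interior_maximal hset isOpen_Iio hw
  have hB : AnalyticOnNhd ℂ (fun w : ℂ => (1 / (-w)) ^ (s : ℂ) * (Real.Gamma s : ℂ))
      {w | w.re < 0} := by
    refine DifferentiableOn.analyticOnNhd (fun w hw => ?_) hopen
    have hw : w.re < 0 := hw
    have hw0 : -w ≠ 0 := by
      rintro h
      rw [neg_eq_zero] at h
      simp [h] at hw
    have hslit : 1 / (-w) ∈ slitPlane := by
      refine Or.inl ?_
      rw [one_div, inv_re]
      exact div_pos (by simpa using hw) (normSq_pos.2 hw0)
    have hd : DifferentiableAt ℂ (fun w : ℂ => 1 / (-w)) w :=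
      (differentiableAt_const _).div differentiableAt_id.neg hw0
    exact ((hd.cpow (differentiableAt_const _) hslit).mul_const _).differentiableWithinAt
  have hpre : IsPreconnected {w : ℂ | w.re < 0} := (convex_halfSpace_re_lt 0).isPreconnected
  have hfreq : ∃ᶠ w in 𝓝[≠] ((-1 : ℝ) : ℂ), ProbabilityTheory.complexMGF id μ w =
      (1 / (-w)) ^ (s : ℂ) * (Real.Gamma s : ℂ) := by
    have htend : Tendsto (fun x : ℝ => (x : ℂ)) (𝓝[≠] (-1)) (𝓝[≠] ((-1 : ℝ) : ℂ)) :=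
      tendsto_nhdsWithin_iff.2 ⟨(continuous_ofReal.tendsto _).mono_left nhdsWithin_le_nhds, by
        filter_upwards [self_mem_nhdsWithin] with x hx
        exact fun h => hx (ofReal_injective h)⟩
    refine htend.frequently (Eventually.frequently ?_)
    have : ∀ᶠ x : ℝ in 𝓝[≠] (-1), x < 0 :=
      nhdsWithin_le_nhds (Iio_mem_nhds (by norm_num))
    filter_upwards [this] with x hx
    have hx' : 0 < -x := by linarith
    have h := Complex.integral_cpow_mul_exp_neg_mul_Ioi (a := s) (r := -x) (by simpa using hs) hx'
    rw [hF, ← Complex.Gamma_ofReal, ← ofReal_neg, ← h]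
    refine setIntegral_congr_fun measurableSet_Ioi fun t ht => ?_
    have ht : 0 < t := ht
    simp only [ofReal_neg, neg_mul, neg_neg]
    rw [ofReal_cpow ht.le]
    push_cast
    rfl
  have := hA.eqOn_of_preconnected_of_frequently_eq hB hpre (by simp) hfreq
    (show -z ∈ {w : ℂ | w.re < 0} by simpa using hz)
  rw [hF] at this
  simpa using this

/-- The function `e^{-at-bt²}` is a superposition of the exponentials `e^{-(1+ip)t}`. -/
lemma exists_exp_quadratic_eq_integral (a : ℝ) {b : ℝ} (hb : 0 < b) :
    ∃ G : ℝ → ℂ, Integrable G ∧ ∀ t : ℝ,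
      exp (-((a * t + b * t ^ 2 : ℝ) : ℂ)) = ∫ p, G p * exp (-((1 + p * I) * t)) := by
  set m : ℝ := (a - 1) / (2 * b) with hm
  set β : ℝ := (4 * b)⁻¹ with hβ
  have hβ0 : 0 < β := by positivity
  have hbC : (b : ℂ) ≠ 0 := by exact_mod_cast hb.ne'
  set κ : ℂ := ((Real.pi : ℂ) / β) ^ (1 / 2 : ℂ) with hκ
  have hκ0 : κ ≠ 0 := by
    rw [hκ, cpow_def_of_ne_zero]
    · exact exp_ne_zero _
    · have := Real.pi_pos.ne'
      simp [this, hβ0.ne']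
  refine ⟨fun p => κ⁻¹ * exp (b * m ^ 2) * exp (-(β : ℂ) * p ^ 2 + (-(I * m)) * p + 0),
    (integrable_cexp_quadratic (by simpa using hβ0) _ _).const_mul _, fun t => ?_⟩
  have h := integral_cexp_quadratic (b := -(β : ℂ)) (by simpa using hβ0) (-(I * (t + m))) (-t)
  have heq : ∀ p : ℝ, κ⁻¹ * exp (b * m ^ 2) * exp (-(β : ℂ) * p ^ 2 + (-(I * m)) * p + 0) *
      exp (-((1 + p * I) * t)) =
      κ⁻¹ * exp (b * m ^ 2) * exp (-(β : ℂ) * p ^ 2 + -(I * (t + m)) * p + -t) := fun p => by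
    rw [mul_assoc (κ⁻¹ * _), ← exp_add]; congr 2; ring
  simp_rw [heq]
  rw [integral_const_mul, h, neg_neg, ← hκ]
  have h2 : κ⁻¹ * exp (b * m ^ 2) * (κ * exp (-t - (-(I * (t + m))) ^ 2 / (4 * -(β : ℂ)))) =
      exp (b * m ^ 2 + (-t - (-(I * (t + m))) ^ 2 / (4 * -(β : ℂ)))) := by
    rw [exp_add]; field_simp
  rw [h2]
  congr 1
  rw [neg_sq, mul_pow, I_sq, hβ, hm]
  push_cast
  field_simp
  ring

lemma integral_mul_exp_quadratic {α : Type*} [MeasurableSpace α] {μ : Measure α} [SFinite μ]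
    {a b : ℝ} {G : ℝ → ℂ} (hG : Integrable G)
    (h : ∀ t : ℝ, exp (-((a * t + b * t ^ 2 : ℝ) : ℂ)) = ∫ p, G p * exp (-((1 + p * I) * t)))
    {f : α → ℂ} {τ : α → ℝ} (hτ : Measurable τ)
    (hf : Integrable (fun x => f x * exp (-(τ x))) μ) :
    ∫ x, f x * exp (-((a * τ x + b * τ x ^ 2 : ℝ) : ℂ)) ∂μ =
      ∫ p, G p * ∫ x, f x * exp (-((1 + p * I) * τ x)) ∂μ := by
  simp_rw [h, ← integral_const_mul]
  rw [integral_integral_swap]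
  · refine integral_congr_ae (.of_forall fun p => integral_congr_ae (.of_forall fun x => ?_))
    simp only
    ring
  · have hosc : AEStronglyMeasurable (fun q : α × ℝ => exp (-(q.2 * τ q.1 * I))) (μ.prod volume) :=
      Measurable.aestronglyMeasurable (by fun_prop)
    refine ((hf.mul_prod hG).mul_bdd (c := 1) hosc (.of_forall fun q => ?_)).congr
      (.of_forall fun q => ?_)
    · rw [show -((q.2 : ℂ) * τ q.1 * I) = ((-(q.2 * τ q.1) : ℝ) : ℂ) * I by push_cast; ring,
        norm_exp_ofReal_mul_I]
    · have : -((1 + (q.2 : ℂ) * I) * τ q.1) = -(τ q.1) + -(q.2 * τ q.1 * I) := by ring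
      simp only [Function.uncurry, this, exp_add]
      ring

lemma integral_rpow_mul_exp_quadratic {a b : ℝ} {G : ℝ → ℂ} (hG : Integrable G)
    (h : ∀ t : ℝ, exp (-((a * t + b * t ^ 2 : ℝ) : ℂ)) = ∫ p, G p * exp (-((1 + p * I) * t)))
    {s : ℝ} (hs : 0 < s) :
    ((∫ t in Set.Ioi (0 : ℝ), t ^ (s - 1) * Real.exp (-(a * t + b * t ^ 2)) : ℝ) : ℂ) =
      (∫ p, G p * (1 / (1 + p * I)) ^ (s : ℂ)) * Real.Gamma s := by
  have hf : Integrable (fun t : ℝ => ((t ^ (s - 1) : ℝ) : ℂ) * exp (-t))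
      (volume.restrict (Set.Ioi 0)) := by
    refine (integrableOn_rpow_mul_exp_neg_mul hs one_pos).ofReal.congr (.of_forall fun t => ?_)
    simp
  have := integral_mul_exp_quadratic hG h measurable_id hf
  rw [← integral_complex_ofReal, ← integral_mul_const]
  simp only [id] at this
  push_cast at this ⊢
  rw [this]
  refine integral_congr_ae (.of_forall fun p => ?_)
  have hp := integral_rpow_mul_cexp_neg_mul hs (z := 1 + p * I) (by simp)
  simp only
  rw [hp, mul_assoc]

lemma integral_cexp_cpair_sub {D : ℕ} (z : Fin D → ℂ) {s : ℂ} (hs : 0 < s.re) :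
    ∫ σ : Fin D → ℝ, exp (cpair z σ) * exp (-(s * (rdot σ σ : ℝ))) =
      ((Real.pi ^ ((D : ℝ) / 2) : ℝ) : ℂ) *
        ((1 / s) ^ (((D : ℝ) / 2 : ℝ) : ℂ) * exp (cdot z z / 4 * (1 / s))) := by
  have hs0 : s ≠ 0 := by rintro rfl; simp at hs
  have h := GaussianFourier.integral_cexp_neg_mul_sum_add hs z
  have hpow : ((Real.pi : ℂ) / s) ^ ((Fintype.card (Fin D) : ℂ) / 2) =
      ((Real.pi ^ ((D : ℝ) / 2) : ℝ) : ℂ) * (1 / s) ^ (((D : ℝ) / 2 : ℝ) : ℂ) := by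
    have hpi : (Real.pi : ℂ) ≠ 0 := by exact_mod_cast Real.pi_pos.ne'
    have hs1 : 1 / s ≠ 0 := one_div_ne_zero hs0
    rw [ofReal_cpow Real.pi_pos.le, div_eq_mul_one_div, cpow_def_of_ne_zero (mul_ne_zero hpi hs1),
      cpow_def_of_ne_zero hpi, cpow_def_of_ne_zero hs1, ← exp_add,
      log_ofReal_mul Real.pi_pos hs1, ofReal_log Real.pi_pos.le, Fintype.card_fin]
    push_cast
    ring_nf
  rw [hpow, mul_assoc] at h
  convert h using 2
  · ext σ
    rw [← exp_add]
    simp only [cpair, rdot]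
    push_cast
    congr 1
    simp_rw [← pow_two]
    ring
  · congr 2
    simp only [cdot, pow_two]
    field_simp

lemma norm_one_div_one_add_mul_I_le (p : ℝ) : ‖1 / (1 + p * I)‖ ≤ 1 := by
  have h := abs_re_le_norm (1 + p * I)
  simp only [add_re, one_re, mul_re, ofReal_re, I_re, mul_zero, ofReal_im, I_im, mul_one, sub_self,
    add_zero, abs_one] at h
  rw [norm_div, norm_one]
  exact div_le_one_of_le₀ h (norm_nonneg _)

/-- The Laplace transform of the `φ⁴` weight as a power series in `z²/4`. -/
theorem integral_phi4_eq_tsum {D : ℕ} (hD : 0 < D) (a : ℝ) {b : ℝ} (hb : 0 < b) (z : Fin D → ℂ) :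
    ∫ σ : Fin D → ℝ, exp (cpair z σ - ((a * rdot σ σ + b * (rdot σ σ) ^ 2 : ℝ) : ℂ)) =
      ((Real.pi ^ ((D : ℝ) / 2) : ℝ) : ℂ) *
        ∑' k, (phiCoeff a b ((D : ℝ) / 2) k : ℂ) * (cdot z z / 4) ^ k := by
  obtain ⟨G, hG, h⟩ := exists_exp_quadratic_eq_integral a hb
  set δ : ℝ := (D : ℝ) / 2 with hδ
  have hδ0 : 0 < δ := by positivity
  set w : ℂ := cdot z z / 4 with hw
  set u : ℝ → ℂ := fun p => 1 / (1 + p * I) with hu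
  have hu0 : ∀ p, u p ≠ 0 := fun p => one_div_ne_zero fun h0 => by
    simpa using congrArg re h0
  have humeas : Measurable u := by fun_prop
  have hu1 : ∀ p, ‖u p‖ ≤ 1 := norm_one_div_one_add_mul_I_le
  have hrdot : Measurable fun σ : Fin D → ℝ => rdot σ σ := by unfold rdot; fun_prop
  have hInt : Integrable fun σ : Fin D → ℝ => exp (cpair z σ) * exp (-((rdot σ σ : ℝ) : ℂ)) := by
    refine (GaussianFourier.integrable_cexp_neg_mul_sum_add (b := 1) (by simp) z).congr
      (.of_forall fun σ => ?_)
    simp only [cpair, rdot]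
    rw [← exp_add]
    push_cast
    simp_rw [← pow_two]
    congr 1
    ring
  have hsum : HasSum (fun k : ℕ => ∫ p, G p * (u p ^ (δ : ℂ) * ((w * u p) ^ k / k.factorial)))
      (∫ p, G p * (u p ^ (δ : ℂ) * exp (w * u p))) := by
    refine hasSum_integral_of_dominated_convergence
      (fun k p => ‖G p‖ * (‖w‖ ^ k / k.factorial)) (fun k => ?_) (fun k => ?_) ?_ ?_ ?_
    · exact hG.aestronglyMeasurable.mul (Measurable.aestronglyMeasurable (by fun_prop))
    · refine .of_forall fun p => ?_
      rw [norm_mul, norm_mul, norm_cpow_real, norm_div (_ ^ k), norm_pow, norm_mul, norm_natCast]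
      gcongr
      calc ‖u p‖ ^ δ * ((‖w‖ * ‖u p‖) ^ k / k.factorial)
          ≤ 1 * ((‖w‖ * 1) ^ k / k.factorial) := by
            gcongr
            · exact Real.rpow_le_one (norm_nonneg _) (hu1 p) hδ0.le
            · exact hu1 p
        _ = _ := by rw [one_mul, mul_one]
    · exact .of_forall fun p => (Real.summable_pow_div_factorial _).mul_left _
    · simp_rw [tsum_mul_left]
      exact hG.norm.mul_const _
    · refine .of_forall fun p => ?_
      have := NormedSpace.expSeries_div_hasSum_exp (w * u p)
      rw [← exp_eq_exp_ℂ] at this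
      exact (this.mul_left _).mul_left _
  have hterm : ∀ k : ℕ, ∫ p, G p * (u p ^ (δ : ℂ) * ((w * u p) ^ k / k.factorial)) =
      (phiCoeff a b δ k : ℂ) * w ^ k := fun k => by
    have hk : 0 < k + δ := by positivity
    have hΓ : ((Real.Gamma (k + δ) : ℝ) : ℂ) ≠ 0 := by
      exact_mod_cast (Real.Gamma_pos_of_pos hk).ne'
    have hk0 : ((k.factorial : ℕ) : ℂ) ≠ 0 := by exact_mod_cast k.factorial_ne_zero
    have heq : ∀ p, G p * (u p ^ (δ : ℂ) * ((w * u p) ^ k / k.factorial)) =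
        w ^ k / k.factorial * (G p * u p ^ ((k + δ : ℝ) : ℂ)) := fun p => by
      rw [ofReal_add, ofReal_natCast, cpow_add _ _ (hu0 p), cpow_natCast, mul_pow]
      ring
    simp_rw [heq]
    rw [integral_const_mul, phiCoeff, ofReal_div, integral_rpow_mul_exp_quadratic hG h hk]
    push_cast
    field_simp
    rfl
  calc _ = ∫ σ : Fin D → ℝ, exp (cpair z σ) *
        exp (-((a * rdot σ σ + b * (rdot σ σ) ^ 2 : ℝ) : ℂ)) := by
        simp_rw [← exp_add, ← sub_eq_add_neg]
    _ = ∫ p, G p * ∫ σ : Fin D → ℝ, exp (cpair z σ) * exp (-((1 + p * I) * (rdot σ σ : ℝ))) :=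
        integral_mul_exp_quadratic hG h hrdot hInt
    _ = ∫ p, ((Real.pi ^ δ : ℝ) : ℂ) * (G p * (u p ^ (δ : ℂ) * exp (w * u p))) := by
        refine integral_congr_ae (.of_forall fun p => ?_)
        simp only
        rw [integral_cexp_cpair_sub z (by simp)]
        ring
    _ = _ := by
        rw [integral_const_mul, ← hsum.tsum_eq]
        simp_rw [hterm]

end LeeYang

/-- **The `φ⁴` single-spin measure `exp(-a|σ|² - b|σ|⁴)dσ` has the Lee–Yang property
in every dimension `D`.** -/
theorem leeYang_phi4
    (D : ℕ) (hD : 0 < D) (a b : ℝ) (hb : 0 < b) :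
    ∃ (C : ℝ) (γ : ℕ → ℝ), 0 < C ∧ (∀ j, 0 ≤ γ j) ∧ Summable γ ∧
      ∀ z : Fin D → ℂ,
        (∫ σ : Fin D → ℝ,
          Complex.exp (cpair z σ - ((a * rdot σ σ + b * (rdot σ σ) ^ 2 : ℝ) : ℂ)))
          = (C : ℂ) * ∏' j, (1 + (γ j : ℂ) * cdot z z) := by
  have hδ : 0 < (D : ℝ) / 2 := by positivity
  have h0 := LeeYang.phiCoeff_zero_pos a hb hδ
  obtain ⟨γ, hγ0, hγ, h⟩ := LeeYang.exists_tsum_eq_tprod (LeeYang.phiCoeff_mem_stableSeq a hb hδ) h0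
    fun ε hε => LeeYang.phiCoeff_decay a hb hδ hε
  refine ⟨Real.pi ^ ((D : ℝ) / 2) * LeeYang.phiCoeff a b (D / 2) 0, fun j => γ j / 4,
    mul_pos (by positivity) h0, fun j => div_nonneg (hγ0 j) (by norm_num), hγ.div_const 4,
    fun z => ?_⟩
  rw [LeeYang.integral_phi4_eq_tsum hD a hb z, h, ofReal_mul, mul_assoc]
  congr 2
  refine tprod_congr fun j => ?_
  push_cast
  ring
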